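/- arXiv:1706.02756 — 2 statements merged into one kernel-verified Lean document; each statement's English description precedes it below -/
import Mathlib

section
/- Let G be a finite group, N a normal subgroup of G, and θ a finite-dimensional complex representation of N. Then α(θ) divides α(θ^G), where θ^G is the representation of G induced from θ. -/
namespace AlphaChar

variable {G : Type*} [Group G] {V : Type*} [AddCommMonoid V] [Module ℂ V]

/-- The cardinality of the orbit of a vector `v` under the linear action of `G` via `ρ`. -/
noncomputable def orbitCard (ρ : Representation ℂ G V) (v : V) : ℕ :=
  Nat.card (Set.range fun g : G => ρ g v)

open Classical in
/-- The α-characteristic of a representation: the gcd of the cardinalities of the orbits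
of all nonzero vectors. -/
noncomputable def alphaChar [Finite G] (ρ : Representation ℂ G V) : ℕ :=
  ((Finset.range (Nat.card G + 1)).filter
    (fun n => ∃ v : V, v ≠ 0 ∧ orbitCard ρ v = n)).gcd id

/-- A representation is nontrivial if some group element acts as a non-identity operator. -/
def IsNontrivial (ρ : Representation ℂ G V) : Prop := ∃ g : G, ρ g ≠ 1

/-- A representation is irreducible if the space is nonzero and the only invariant
subspaces are `⊥` and `⊤`. -/
def IsIrreducible (ρ : Representation ℂ G V) : Prop :=
  Nontrivial V ∧
    ∀ U : Submodule ℂ V, (∀ (g : G) (v : V), v ∈ U → ρ g v ∈ U) → U = ⊥ ∨ U = ⊤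

end AlphaChar

namespace AlphaChar

variable {G : Type*} [Group G] (N : Subgroup G)
variable {W : Type*} [AddCommGroup W] [Module ℂ W]

/-- The space of the representation of `G` induced from a representation `θ` of a
subgroup `N`: functions `f : G → W` with `f (g * n) = θ n⁻¹ (f g)` (for finite groups
this coinduction model realizes the induced representation). -/
def inducedSpace (θ : Representation ℂ ↥N W) : Submodule ℂ (G → W) where
  carrier := {f | ∀ (g : G) (n : ↥N), f (g * n) = θ n⁻¹ (f g)}
  zero_mem' := by intro g n; simp
  add_mem' := by
    intro a b ha hb g n
    simp only [Pi.add_apply, ha g n, hb g n, map_add]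
  smul_mem' := by
    intro c f hf g n
    simp only [Pi.smul_apply, hf g n, map_smul]

/-- The representation of `G` induced from the representation `θ` of the subgroup `N`,
given by `(g · f) x = f (g⁻¹ * x)` on `inducedSpace N θ`. -/
def inducedRep (θ : Representation ℂ ↥N W) : Representation ℂ G ↥(inducedSpace N θ) where
  toFun g :=
    { toFun := fun f => ⟨fun x => f.1 (g⁻¹ * x), by
        intro x n
        have := f.2 (g⁻¹ * x) n
        simpa [mul_assoc] using this⟩
      map_add' := by intro f₁ f₂; ext x; rfl
      map_smul' := by intro c f; ext x; rfl }
  map_one' := by ext f x; simp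
  map_mul' := by
    intro a b
    ext f x
    simp [mul_assoc]

end AlphaChar

namespace AlphaChar

section OrbitStabilizer

variable {G : Type*} [Group G] {V : Type*} [AddCommMonoid V] [Module ℂ V]

/-- The stabilizer of a vector `v` under the linear action of `G` via `ρ`. -/
def vectorStabilizer (ρ : Representation ℂ G V) (v : V) : Subgroup G :=
  letI := MulAction.compHom V ρ
  MulAction.stabilizer G v

theorem mem_vectorStabilizer {ρ : Representation ℂ G V} {v : V} {g : G} :
    g ∈ vectorStabilizer ρ v ↔ ρ g v = v :=
  Iff.rfl

theorem orbitCard_eq_index (ρ : Representation ℂ G V) (v : V) :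
    orbitCard ρ v = (vectorStabilizer ρ v).index :=
  letI := MulAction.compHom V ρ
  (MulAction.index_stabilizer G v).symm

theorem alphaChar_dvd_orbitCard [Finite G] (ρ : Representation ℂ G V) {v : V} (hv : v ≠ 0) :
    alphaChar ρ ∣ orbitCard ρ v := by
  classical
  refine Finset.gcd_dvd (f := id) (Finset.mem_filter.2 ⟨?_, v, hv, rfl⟩)
  exact Finset.mem_range_succ_iff.2 (Finite.card_range_le _)

theorem dvd_alphaChar [Finite G] {ρ : Representation ℂ G V} {d : ℕ}
    (h : ∀ v : V, v ≠ 0 → d ∣ orbitCard ρ v) : d ∣ alphaChar ρ := by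
  classical
  refine Finset.dvd_gcd fun n hn => ?_
  obtain ⟨-, v, hv, rfl⟩ := Finset.mem_filter.1 hn
  exact h v hv

end OrbitStabilizer

theorem relIndex_dvd_index_of_normal_right {G : Type*} [Group G] [Finite G] (H K : Subgroup G)
    [K.Normal] : H.relIndex K ∣ H.index := by
  obtain ⟨c, hc⟩ := Subgroup.relIndex_dvd_index_of_normal K H
  have h₁ := Subgroup.relIndex_mul_index (inf_le_left : H ⊓ K ≤ H)
  have h₂ := Subgroup.relIndex_mul_index (inf_le_right : H ⊓ K ≤ K)
  rw [Subgroup.inf_relIndex_left] at h₁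
  rw [Subgroup.inf_relIndex_right, hc, ← h₁, mul_left_comm] at h₂
  have h₀ : K.relIndex H ≠ 0 := (K.subgroupOf H).index_ne_zero_of_finite
  exact ⟨c, (Nat.eq_of_mul_eq_mul_left (Nat.pos_of_ne_zero h₀) h₂).symm⟩

section Induced

variable {G : Type*} [Group G] (N : Subgroup G) [N.Normal]
variable {W : Type*} [AddCommGroup W] [Module ℂ W]

/-- For normal `N`, an element of `N` acts on the values at `x` of an induced vector through its
conjugate by `x⁻¹`. -/
theorem inducedRep_apply_of_mem (θ : Representation ℂ ↥N W) (f : inducedSpace N θ) (n : N)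
    (x : G) : (inducedRep N θ n f).1 x = θ (MulAut.conjNormal x⁻¹ n) (f.1 x) := by
  have h := f.2 x (MulAut.conjNormal x⁻¹ n)⁻¹
  rw [inv_inv] at h
  rw [← h]
  change f.1 ((n : G)⁻¹ * x) = _
  simp [mul_assoc]

/-- For normal `N`, the size of the `N`-orbit of any value of an induced vector divides the size
of the `G`-orbit of that vector. -/
theorem orbitCard_apply_dvd_orbitCard_inducedRep [Finite G] (θ : Representation ℂ ↥N W)
    (f : inducedSpace N θ) (x : G) :
    orbitCard θ (f.1 x) ∣ orbitCard (inducedRep N θ) f := by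
  let c : N ≃* N := MulAut.conjNormal x⁻¹
  rw [orbitCard_eq_index, orbitCard_eq_index,
    ← Subgroup.index_comap_of_surjective _ (f := c.toMonoidHom) c.surjective]
  refine (Subgroup.index_dvd_of_le (H := (vectorStabilizer (inducedRep N θ) f).subgroupOf N)
    fun n hn => ?_).trans (relIndex_dvd_index_of_normal_right _ N)
  have hn' : inducedRep N θ n f = f := hn
  refine mem_vectorStabilizer.2 ?_
  change θ (MulAut.conjNormal x⁻¹ n) (f.1 x) = f.1 x
  rw [← inducedRep_apply_of_mem, hn']

end Induced

end AlphaChar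

open AlphaChar in
/-- for a normal subgroup N, α(θ) divides α(θ^G). -/
theorem alphaChar_dvd_alphaChar_induced {G : Type} [Group G] [Finite G]
    (N : Subgroup G) [N.Normal] {W : Type} [AddCommGroup W] [Module ℂ W]
    [FiniteDimensional ℂ W] (θ : Representation ℂ ↥N W) :
    alphaChar θ ∣ alphaChar (inducedRep N θ) := by
  refine dvd_alphaChar fun f hf => ?_
  obtain ⟨x, hx⟩ : ∃ x, f.1 x ≠ 0 := Function.ne_iff.1 fun h => hf (Subtype.ext h)
  exact (alphaChar_dvd_orbitCard θ hx).trans (orbitCard_apply_dvd_orbitCard_inducedRep N θ f x)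
end

section
/- Let G be a finite group, p a prime, P a Sylow p-subgroup of G, and ρ a nontrivial irreducible finite-dimensional complex representation of G. Then α(ρ|_P) equals the p-part of α(ρ), i.e., α(ρ|_P) is the highest power of p dividing α(ρ). -/
namespace AlphaChar

section MulAction

open MulAction

theorem dvd_natCard_of_forall_dvd_natCard_orbit {H X : Type*} [Group H] [MulAction H X] [Finite X]
    {d : ℕ} (h : ∀ x : X, d ∣ Nat.card (orbit H x)) : d ∣ Nat.card X := by
  classical
  have := Fintype.ofFinite (Quotient (orbitRel H X))
  rw [Nat.card_congr (selfEquivSigmaOrbits H X), Nat.card_sigma]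
  exact Finset.dvd_sum fun ω _ => h _

theorem dvd_natCard_orbit_of_forall_subgroup {G X : Type*} [Group G] [Finite G] [MulAction G X]
    (H : Subgroup G) {d : ℕ} {x : X}
    (h : ∀ y ∈ orbit G x, d ∣ Nat.card (orbit H y)) : d ∣ Nat.card (orbit G x) := by
  have : Finite (orbit G x) := Set.finite_range _
  refine dvd_natCard_of_forall_dvd_natCard_orbit (H := H) fun y => ?_
  have himage : Subtype.val '' orbit H y = orbit H (y : X) := by
    exact (Set.range_comp Subtype.val fun g : H => g • y).symm
  rw [← Nat.card_image_of_injective Subtype.val_injective (orbit H y), himage]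
  exact h y y.2

theorem pow_dvd_natCard_orbit_sylow {G X : Type*} [Group G] [Finite G] [MulAction G X]
    {p : ℕ} [Fact p.Prime] (P : Sylow p G) {k : ℕ} {x : X}
    (h : p ^ k ∣ Nat.card (orbit G x)) : p ^ k ∣ Nat.card (orbit (P : Subgroup G) x) := by
  have hG : Nat.card (orbit G x) * Nat.card (stabilizer G x) = Nat.card G := by
    rw [← Nat.card_prod]
    exact Nat.card_congr (orbitProdStabilizerEquivGroup G x)
  have hP : Nat.card (orbit (P : Subgroup G) x) * Nat.card (stabilizer (P : Subgroup G) x) =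
      Nat.card (P : Subgroup G) := by
    rw [← Nat.card_prod]
    exact Nat.card_congr (orbitProdStabilizerEquivGroup (P : Subgroup G) x)
  obtain ⟨c, hc⟩ : Nat.card (stabilizer (P : Subgroup G) x) ∣ Nat.card (stabilizer G x) := by
    rw [← Subgroup.card_map_of_injective (P : Subgroup G).subtype_injective]
    refine Subgroup.card_dvd_of_le ?_
    rintro _ ⟨g, hg, rfl⟩
    exact hg
  have hcancel : Nat.card (orbit (P : Subgroup G) x) * (P : Subgroup G).index =
      Nat.card (orbit G x) * c := by
    refine Nat.eq_of_mul_eq_mul_left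
      (Nat.card_pos (α := stabilizer (P : Subgroup G) x)) ?_
    calc _ = (Nat.card (orbit (P : Subgroup G) x) *
          Nat.card (stabilizer (P : Subgroup G) x)) * (P : Subgroup G).index := by ring
      _ = Nat.card (orbit G x) * Nat.card (stabilizer G x) := by
          rw [hP, Subgroup.card_mul_index, hG]
      _ = _ := by rw [hc]; ring
  have hcoprime : Nat.Coprime (p ^ k) (P : Subgroup G).index :=
    Nat.Coprime.pow_left k ((Fact.out : p.Prime).coprime_iff_not_dvd.2 P.not_dvd_index)
  exact hcoprime.dvd_of_dvd_mul_right (hcancel ▸ h.mul_right c)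

end MulAction

theorem dvd_alphaChar_iff {G V : Type*} [Group G] [Finite G] [AddCommMonoid V] [Module ℂ V]
    (ρ : Representation ℂ G V) {d : ℕ} :
    d ∣ alphaChar ρ ↔ ∀ v : V, v ≠ 0 → d ∣ orbitCard ρ v := by
  classical
  rw [alphaChar, Finset.dvd_gcd_iff]
  constructor
  · intro h v hv
    refine h _ (Finset.mem_filter.2 ⟨Finset.mem_range_succ_iff.2 ?_, v, hv, rfl⟩)
    exact Finite.card_range_le _
  · rintro h n hn
    obtain ⟨-, v, hv, rfl⟩ := Finset.mem_filter.1 hn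
    exact h v hv

end AlphaChar

open AlphaChar in
/-- for a Sylow p-subgroup P, α(ρ|_P) is the p-part of α(ρ). -/
theorem alphaChar_restrict_sylow {G : Type} [Group G] [Finite G]
    {V : Type} [AddCommGroup V] [Module ℂ V] [FiniteDimensional ℂ V]
    (p : ℕ) (hp : p.Prime) (P : Sylow p G) (ρ : Representation ℂ G V)
    (hnt : IsNontrivial ρ) (hirr : IsIrreducible ρ) :
    alphaChar (ρ.comp (P : Subgroup G).subtype) = p ^ ((alphaChar ρ).factorization p) := by
  have : Fact p.Prime := ⟨hp⟩
  let _ : MulAction G V := MulAction.compHom V ρ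
  have hG (v : V) : orbitCard ρ v = Nat.card (MulAction.orbit G v) := rfl
  have hP (v : V) : orbitCard (ρ.comp (P : Subgroup G).subtype) v =
      Nat.card (MulAction.orbit (P : Subgroup G) v) := rfl
  have := hirr.1
  obtain ⟨v, hv⟩ := exists_ne (0 : V)
  have hne : alphaChar ρ ≠ 0 := by
    intro h0
    have hdvd := (dvd_alphaChar_iff ρ).1 dvd_rfl v hv
    rw [h0, zero_dvd_iff, hG] at hdvd
    have : Finite (MulAction.orbit G v) := Set.finite_range _
    have : Nonempty (MulAction.orbit G v) := (MulAction.nonempty_orbit v).to_subtype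
    exact (Nat.card_pos (α := MulAction.orbit G v)).ne' hdvd
  apply Nat.dvd_antisymm
  · have hdvd : alphaChar (ρ.comp (P : Subgroup G).subtype) ∣ alphaChar ρ := by
      refine (dvd_alphaChar_iff ρ).2 fun w hw => ?_
      rw [hG]
      refine dvd_natCard_orbit_of_forall_subgroup (P : Subgroup G) ?_
      rintro _ ⟨g, rfl⟩
      rw [← hP]
      refine (dvd_alphaChar_iff _).1 dvd_rfl _ fun h => hw ?_
      have h' : ρ g w = 0 := h
      simpa using congrArg (ρ g⁻¹) h'
    have : Finite (MulAction.orbit (P : Subgroup G) v) := Set.finite_range _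
    obtain ⟨n, hn⟩ := P.isPGroup'.card_orbit v
    have hpow := (dvd_alphaChar_iff (ρ.comp (P : Subgroup G).subtype)).1 dvd_rfl v hv
    rw [hP, hn] at hpow
    obtain ⟨m, -, hm⟩ := (Nat.dvd_prime_pow hp).1 hpow
    rw [hm] at hdvd ⊢
    exact pow_dvd_pow p ((hp.pow_dvd_iff_le_factorization hne).1 hdvd)
  · refine (dvd_alphaChar_iff _).2 fun w hw => ?_
    rw [hP]
    refine pow_dvd_natCard_orbit_sylow P ?_
    rw [← hG]
    exact (Nat.ordProj_dvd _ p).trans ((dvd_alphaChar_iff ρ).1 dvd_rfl w hw)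
end
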